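/- arXiv:2304.02878 — 4 statements merged into one kernel-verified Lean document; each statement's English description precedes it below -/
import Mathlib

section
/- Let n ≥ 1 and let s, t be integers with s + 1 ≤ t − 1. For each τ ∈ {s+1, …, t−1}, let H_τ be a real symmetric positive-definite n×n matrix, L_τ a real n×n matrix, and d_τ ≥ 0 a real number. Let ε > 0, β ≥ 0, ρ ∈ (0,1), C > 0, and h, ℓ ≥ 1. Assume: (i) for each k ∈ {s+2, …, t−1}, ‖H_k^{−1/2} H_{k−1}^{1/2}‖ ≤ exp(β d_k / 2) whenever d_k ≤ ε, and ‖H_k^{−1/2} H_{k−1}^{1/2}‖ ≤ h in all cases; (ii) for each τ ∈ {s+1, …, t−1}, ‖L_τ‖ ≤ ρ whenever d_τ ≤ ε, and ‖L_τ‖ ≤ ℓ in all cases; (iii) ‖H_{t−1}^{1/2}‖ · ‖H_{s+1}^{−1/2}‖ ≤ C. Then, writing Δ := Σ_{τ=s+1}^{t−1} d_τ, the ordered matrix product satisfies ‖ (H_{t−1}^{1/2} L_{t−1} H_{t−1}^{−1/2}) (H_{t−2}^{1/2} L_{t−2} H_{t−2}^{−1/2}) ⋯ (H_{s+1}^{1/2}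 L_{s+1} H_{s+1}^{−1/2}) ‖ ≤ C · (ℓh/ρ)^{Δ/ε} · exp(βΔ/2) · ρ^{t−s−1}. -/
open Finset

/-- Operator norm (spectral norm) of a real matrix, induced by the Euclidean norm. -/
noncomputable def opNorm {n : ℕ} (M : Matrix (Fin n) (Fin n) ℝ) : ℝ :=
  ‖(Matrix.toEuclideanCLM (𝕜 := ℝ) M : EuclideanSpace ℝ (Fin n) →L[ℝ] EuclideanSpace ℝ (Fin n))‖

/-- Ordered (descending-index) matrix product `f b * f (b-1) * ⋯ * f a` for integer indices. -/
noncomputable def prodDescZ {n : ℕ} (f : ℤ → Matrix (Fin n) (Fin n) ℝ) (a b : ℤ) :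
    Matrix (Fin n) (Fin n) ℝ :=
  ((List.range (b + 1 - a).toNat).map fun i => f (b - i)).prod

lemma opNorm_nonneg {n : ℕ} (M : Matrix (Fin n) (Fin n) ℝ) : 0 ≤ opNorm M :=
  norm_nonneg _

lemma opNorm_mul_le {n : ℕ} (M N : Matrix (Fin n) (Fin n) ℝ) :
    opNorm (M * N) ≤ opNorm M * opNorm N := by
  unfold opNorm
  rw [map_mul]
  exact norm_mul_le _ _

lemma prodDescZ_eq_prod_map {n : ℕ} (f : ℤ → Matrix (Fin n) (Fin n) ℝ) (a b : ℤ) :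
    prodDescZ f a b = ((List.range (b + 1 - a).toNat).map fun i : ℕ => f (b - (i : ℤ))).prod := by
  simp [prodDescZ, ← List.map_eq_flatMap, Function.comp_def]

lemma prodDescZ_self {n : ℕ} (f : ℤ → Matrix (Fin n) (Fin n) ℝ) (a : ℤ) :
    prodDescZ f a a = f a := by
  simp [prodDescZ_eq_prod_map]

lemma prodDescZ_add_one {n : ℕ} (f : ℤ → Matrix (Fin n) (Fin n) ℝ) {a b : ℤ} (hab : a ≤ b) :
    prodDescZ f a (b + 1) = f (b + 1) * prodDescZ f a b := by
  have hlen : (b + 1 + 1 - a).toNat = (b + 1 - a).toNat + 1 := by omega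
  rw [prodDescZ_eq_prod_map, prodDescZ_eq_prod_map, hlen, List.range_succ_eq_map, List.map_cons, List.prod_cons, List.map_map]
  congr 2
  · simp
  · refine List.map_congr_left fun i _ => ?_
    simp only [Function.comp_apply, Nat.succ_eq_add_one, Nat.cast_add, Nat.cast_one]
    congr 1
    ring

/-- The bound on one step of the product: the growth factor `ℓ * h` of a large movement `d > ε`
is absorbed by the power with exponent `d / ε`. -/
lemma mul_le_of_small_or_large_movement {x y d ε β ρ h ℓ : ℝ} (hd : 0 ≤ d) (hε : 0 < ε)
    (hβ : 0 ≤ β) (hρ0 : 0 < ρ) (hρ1 : ρ < 1) (hh : 1 ≤ h) (hℓ : 1 ≤ ℓ) (hy0 : 0 ≤ y)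
    (hx : (d ≤ ε → x ≤ ρ) ∧ x ≤ ℓ) (hy : (d ≤ ε → y ≤ Real.exp (β * d / 2)) ∧ y ≤ h) :
    x * y ≤ (ℓ * h / ρ) ^ (d / ε) * Real.exp (β * d / 2) * ρ := by
  have hX : 1 ≤ ℓ * h / ρ := by
    rw [le_div_iff₀ hρ0]
    nlinarith
  have hexp : 1 ≤ Real.exp (β * d / 2) := Real.one_le_exp (by positivity)
  rcases le_or_gt d ε with hdε | hdε
  · have hpow : 1 ≤ (ℓ * h / ρ) ^ (d / ε) := Real.one_le_rpow hX (by positivity)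
    calc x * y ≤ ρ * Real.exp (β * d / 2) :=
          mul_le_mul (hx.1 hdε) (hy.1 hdε) hy0 hρ0.le
      _ = 1 * Real.exp (β * d / 2) * ρ := by ring
      _ ≤ _ := by gcongr
  · have hpow : ℓ * h / ρ ≤ (ℓ * h / ρ) ^ (d / ε) :=
      Real.self_le_rpow_of_one_le hX ((one_le_div hε).2 hdε.le)
    calc x * y ≤ ℓ * h := mul_le_mul hx.2 hy.2 hy0 (by positivity)
      _ = ℓ * h / ρ * 1 * ρ := by field_simp
      _ ≤ _ := by gcongr

/-- As `mul_le_of_small_or_large_movement`, for a step with the factor `x` only. -/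
lemma le_of_small_or_large_movement {x d ε β ρ h ℓ : ℝ} (hd : 0 ≤ d) (hε : 0 < ε)
    (hβ : 0 ≤ β) (hρ0 : 0 < ρ) (hρ1 : ρ < 1) (hh : 1 ≤ h) (hℓ : 1 ≤ ℓ)
    (hx : (d ≤ ε → x ≤ ρ) ∧ x ≤ ℓ) :
    x ≤ (ℓ * h / ρ) ^ (d / ε) * Real.exp (β * d / 2) * ρ := by
  simpa using mul_le_of_small_or_large_movement (y := 1) hd hε hβ hρ0 hρ1 hh hℓ zero_le_one hx
    ⟨fun _ => Real.one_le_exp (by positivity), hh⟩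

/-- Telescoping: `(R b)⁻¹` times the product of the conjugates `R τ * L τ * (R τ)⁻¹` is bounded by
the product of the one-step bounds. -/
lemma opNorm_inv_mul_prodDescZ_le {n : ℕ} {R L : ℤ → Matrix (Fin n) (Fin n) ℝ} {g : ℤ → ℝ}
    {a c : ℤ} (hR : ∀ τ ∈ Icc a c, IsUnit (R τ).det) (hg : ∀ τ ∈ Icc a c, 0 ≤ g τ)
    (ha : opNorm (L a) ≤ g a)
    (hstep : ∀ k ∈ Icc (a + 1) c, opNorm (L k) * opNorm ((R k)⁻¹ * R (k - 1)) ≤ g k)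
    {b : ℤ} (hab : a ≤ b) (hbc : b ≤ c) :
    opNorm ((R b)⁻¹ * prodDescZ (fun τ => R τ * L τ * (R τ)⁻¹) a b) ≤
      (∏ τ ∈ Icc a b, g τ) * opNorm ((R a)⁻¹) := by
  induction b, hab using Int.leInduction with
  | base =>
    have hu := hR a (mem_Icc.2 ⟨le_rfl, hbc⟩)
    rw [prodDescZ_self, Icc_self, prod_singleton, Matrix.mul_assoc,
      Matrix.nonsing_inv_mul_cancel_left _ _ hu]
    exact (opNorm_mul_le _ _).trans (mul_le_mul_of_nonneg_right ha (opNorm_nonneg _))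
  | succ b hab ih =>
    have hu := hR b (mem_Icc.2 ⟨hab, by omega⟩)
    have hu' := hR (b + 1) (mem_Icc.2 ⟨by omega, hbc⟩)
    have hk := hstep (b + 1) (mem_Icc.2 ⟨by omega, hbc⟩)
    rw [add_sub_cancel_right] at hk
    have hIcc : Icc a (b + 1) = insert (b + 1) (Icc a b) := by
      ext τ
      simp only [mem_Icc, mem_insert]
      omega
    rw [prodDescZ_add_one _ hab, hIcc, prod_insert (by simp)]
    set P := prodDescZ (fun τ => R τ * L τ * (R τ)⁻¹) a b
    have hfac : (R (b + 1))⁻¹ * (R (b + 1) * L (b + 1) * (R (b + 1))⁻¹ * P) =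
        L (b + 1) * ((R (b + 1))⁻¹ * R b) * ((R b)⁻¹ * P) := by
      simp only [Matrix.mul_assoc]
      rw [Matrix.nonsing_inv_mul_cancel_left _ _ hu', Matrix.mul_nonsing_inv_cancel_left _ _ hu]
    rw [hfac, mul_assoc (g (b + 1))]
    refine (opNorm_mul_le _ _).trans ?_
    exact mul_le_mul ((opNorm_mul_le _ _).trans hk) (ih (by omega)) (opNorm_nonneg _)
      (hg _ (mem_Icc.2 ⟨by omega, hbc⟩))

theorem prod_norm_bound_small_movement
    (n : ℕ) (hn : 1 ≤ n) (s t : ℤ) (hst : s + 1 ≤ t - 1)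
    (H L : ℤ → Matrix (Fin n) (Fin n) ℝ) (R : ℤ → Matrix (Fin n) (Fin n) ℝ) (d : ℤ → ℝ)
    (hH : ∀ τ ∈ Icc (s + 1) (t - 1), (H τ).PosDef)
    (hR : ∀ τ ∈ Icc (s + 1) (t - 1), (R τ).PosDef ∧ R τ * R τ = H τ ∧ (R τ).IsSymm)
    (hd : ∀ τ ∈ Icc (s + 1) (t - 1), 0 ≤ d τ)
    (ε β ρ C h ℓ : ℝ)
    (hε : 0 < ε) (hβ : 0 ≤ β) (hρ0 : 0 < ρ) (hρ1 : ρ < 1) (hC : 0 < C) (hh : 1 ≤ h) (hℓ : 1 ≤ ℓ)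
    (hi : ∀ k ∈ Icc (s + 2) (t - 1),
      (d k ≤ ε → opNorm ((R k)⁻¹ * R (k - 1)) ≤ Real.exp (β * d k / 2)) ∧
        opNorm ((R k)⁻¹ * R (k - 1)) ≤ h)
    (hii : ∀ τ ∈ Icc (s + 1) (t - 1),
      (d τ ≤ ε → opNorm (L τ) ≤ ρ) ∧ opNorm (L τ) ≤ ℓ)
    (hiii : opNorm (R (t - 1)) * opNorm ((R (s + 1))⁻¹) ≤ C) :
    opNorm (prodDescZ (fun τ => R τ * L τ * (R τ)⁻¹) (s + 1) (t - 1)) ≤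
      C * (ℓ * h / ρ) ^ ((∑ τ ∈ Icc (s + 1) (t - 1), d τ) / ε) *
        Real.exp (β * (∑ τ ∈ Icc (s + 1) (t - 1), d τ) / 2) * ρ ^ (t - s - 1) := by
  have hdet : ∀ τ ∈ Icc (s + 1) (t - 1), IsUnit (R τ).det := fun τ hτ =>
    (hR τ hτ).1.det_pos.ne'.isUnit
  have hX : 0 < ℓ * h / ρ := by positivity
  have hfirst : s + 1 ∈ Icc (s + 1) (t - 1) := mem_Icc.2 ⟨le_rfl, hst⟩
  have hlast : t - 1 ∈ Icc (s + 1) (t - 1) := mem_Icc.2 ⟨hst, le_rfl⟩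
  have hsub : ∀ k ∈ Icc (s + 1 + 1) (t - 1), k ∈ Icc (s + 1) (t - 1) ∧ k ∈ Icc (s + 2) (t - 1) := by
    intro k hk
    simp only [mem_Icc] at hk ⊢
    omega
  set g : ℤ → ℝ := fun τ => (ℓ * h / ρ) ^ (d τ / ε) * Real.exp (β * d τ / 2) * ρ
  have hbound := opNorm_inv_mul_prodDescZ_le (g := g) hdet
    (fun τ _ => by positivity)
    (le_of_small_or_large_movement (hd _ hfirst) hε hβ hρ0 hρ1 hh hℓ (hii _ hfirst))
    (fun k hk => mul_le_of_small_or_large_movement (hd _ (hsub k hk).1) hε hβ hρ0 hρ1 hh hℓ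
      (opNorm_nonneg _) (hii _ (hsub k hk).1) (hi _ (hsub k hk).2))
    hst le_rfl
  have hprod : ∏ τ ∈ Icc (s + 1) (t - 1), g τ =
      (ℓ * h / ρ) ^ ((∑ τ ∈ Icc (s + 1) (t - 1), d τ) / ε) *
        Real.exp (β * (∑ τ ∈ Icc (s + 1) (t - 1), d τ) / 2) * ρ ^ (t - s - 1) := by
    have hcard : ((t - 1 + 1 - (s + 1)).toNat : ℤ) = t - s - 1 := by omega
    rw [prod_mul_distrib, prod_mul_distrib, ← Real.rpow_sum_of_pos hX, ← Real.exp_sum,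
      prod_const, Int.card_Icc, ← sum_div, ← sum_div, ← mul_sum, ← hcard, zpow_natCast]
  have hprod_nonneg : 0 ≤ ∏ τ ∈ Icc (s + 1) (t - 1), g τ :=
    prod_nonneg fun τ _ => by positivity
  set P := prodDescZ (fun τ => R τ * L τ * (R τ)⁻¹) (s + 1) (t - 1)
  calc opNorm P = opNorm (R (t - 1) * ((R (t - 1))⁻¹ * P)) := by
        rw [Matrix.mul_nonsing_inv_cancel_left _ _ (hdet _ hlast)]
    _ ≤ opNorm (R (t - 1)) * ((∏ τ ∈ Icc (s + 1) (t - 1), g τ) * opNorm ((R (s + 1))⁻¹)) :=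
        (opNorm_mul_le _ _).trans (mul_le_mul_of_nonneg_left hbound (opNorm_nonneg _))
    _ = opNorm (R (t - 1)) * opNorm ((R (s + 1))⁻¹) * ∏ τ ∈ Icc (s + 1) (t - 1), g τ := by ring
    _ ≤ C * ∏ τ ∈ Icc (s + 1) (t - 1), g τ := mul_le_mul_of_nonneg_right hiii hprod_nonneg
    _ = _ := by rw [hprod]; ring
end

section
/- Let c₁ > 0, c₂ ≥ 1, ρ ∈ (0,1), and δ > 0 be such that ρ · c₂^{δ} ≤ (1+ρ)/2. Let (θ_t)_{t≥0} be a sequence in a normed space whose per-step variation satisfies ‖θ_τ − θ_{τ−1}‖ ≤ δ for all τ ≥ 1, and write Δ_{[s,e]} := Σ_{τ=s+1}^{e} ‖θ_τ − θ_{τ−1}‖. Suppose (x_k)_{k≥0} satisfies ‖x_k‖ ≤ c₁ · Σ_{s=0}^{k−2} c₂^{Δ_{[s,k−1]}} ρ^{k−s} for every k ≥ 0. Then for every k, ‖x_k‖ ≤ 2c₁ / (1 − ρ). -/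
open Finset

theorem sum_partial_variation_le {E : Type*} [NormedAddCommGroup E] {θ : ℕ → E} {δ : ℝ}
    (hθ : ∀ τ : ℕ, 1 ≤ τ → ‖θ τ - θ (τ - 1)‖ ≤ δ) {s n : ℕ} :
    ∑ τ ∈ Icc (s + 1) n, ‖θ τ - θ (τ - 1)‖ ≤ δ * (n - s : ℕ) := by
  calc ∑ τ ∈ Icc (s + 1) n, ‖θ τ - θ (τ - 1)‖
      ≤ #(Icc (s + 1) n) • δ :=
        sum_le_card_nsmul _ _ _ fun τ hτ => hθ τ (by have := mem_Icc.1 hτ; omega)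
    _ = δ * (n - s : ℕ) := by
        rw [Nat.card_Icc, Nat.add_sub_add_right, nsmul_eq_mul, mul_comm]

theorem sum_range_pow_sub_le {q : ℝ} (hq0 : 0 ≤ q) (hq1 : q < 1) (n : ℕ) :
    ∑ s ∈ range n, q ^ (n - s) ≤ (1 - q)⁻¹ := by
  calc ∑ s ∈ range n, q ^ (n - s)
      ≤ ∑ s ∈ range n, q ^ (n - 1 - s) :=
        sum_le_sum fun s _ => pow_le_pow_of_le_one hq0 hq1.le (by omega)
    _ = ∑ s ∈ range n, q ^ s := sum_range_reflect (q ^ ·) n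
    _ ≤ ∑' s, q ^ s :=
        (summable_geometric_of_lt_one hq0 hq1).sum_le_tsum _ fun s _ => pow_nonneg hq0 s
    _ = (1 - q)⁻¹ := tsum_geometric_of_lt_one hq0 hq1

theorem sublinear_variation_BIBO
    {E F : Type*} [NormedAddCommGroup E] [NormedAddCommGroup F]
    (c₁ c₂ ρ δ : ℝ)
    (hc₁ : 0 < c₁) (hc₂ : 1 ≤ c₂) (hρ0 : 0 < ρ) (hρ1 : ρ < 1) (hδ : 0 < δ)
    (hcond : ρ * c₂ ^ δ ≤ (1 + ρ) / 2)
    (θ : ℕ → E) (hθ : ∀ τ : ℕ, 1 ≤ τ → ‖θ τ - θ (τ - 1)‖ ≤ δ)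
    (x : ℕ → F)
    (hx : ∀ k : ℕ, ‖x k‖ ≤ c₁ *
      ∑ s ∈ range (k - 1), c₂ ^ (∑ τ ∈ Icc (s + 1) (k - 1), ‖θ τ - θ (τ - 1)‖) * ρ ^ (k - s)) :
    ∀ k : ℕ, ‖x k‖ ≤ 2 * c₁ / (1 - ρ) := by
  intro k
  have hc₂0 : 0 ≤ c₂ := by linarith
  have hterm : ∀ s ∈ range (k - 1),
      c₂ ^ (∑ τ ∈ Icc (s + 1) (k - 1), ‖θ τ - θ (τ - 1)‖) * ρ ^ (k - s) ≤
        ((1 + ρ) / 2) ^ (k - 1 - s) := by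
    intro s _
    calc c₂ ^ (∑ τ ∈ Icc (s + 1) (k - 1), ‖θ τ - θ (τ - 1)‖) * ρ ^ (k - s)
        ≤ c₂ ^ (δ * (k - 1 - s : ℕ)) * ρ ^ (k - 1 - s) := by
          exact mul_le_mul (Real.rpow_le_rpow_of_exponent_le hc₂ (sum_partial_variation_le hθ))
            (pow_le_pow_of_le_one hρ0.le hρ1.le (by omega)) (by positivity) (by positivity)
      _ = (ρ * c₂ ^ δ) ^ (k - 1 - s) := by
          rw [Real.rpow_mul hc₂0, Real.rpow_natCast, mul_pow, mul_comm]
      _ ≤ ((1 + ρ) / 2) ^ (k - 1 - s) := by gcongr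
  calc ‖x k‖
      ≤ c₁ * ∑ s ∈ range (k - 1),
          c₂ ^ (∑ τ ∈ Icc (s + 1) (k - 1), ‖θ τ - θ (τ - 1)‖) * ρ ^ (k - s) := hx k
    _ ≤ c₁ * (1 - (1 + ρ) / 2)⁻¹ := by
        gcongr
        exact (sum_le_sum hterm).trans
          (sum_range_pow_sub_le (by linarith) (by linarith) (k - 1))
    _ = 2 * c₁ / (1 - ρ) := by
        rw [show 1 - (1 + ρ) / 2 = (1 - ρ) / 2 by ring, inv_div]
        ring
end

section
/- Let Θ ⊆ ℝⁿ be a convex compact set with diameter D := max_{a,b∈Θ} ‖a − b‖, let q₀ ∈ Θ, and let K₁, …, K_e ⊆ Θ be nonempty compact convex sets. Let (q₁*, …, q_e*) with q_τ* ∈ K_τ be a minimizer of the total path length Σ_{τ=1}^{e} ‖q_τ − q_{τ−1}‖ over all selections q_τ ∈ K_τ (with q₀ fixed, q₀* := q₀). Then for every integer s with 1 ≤ s < e, the prefix cost satisfies Σ_{τ=1}^{s} ‖q_τ* − q_{τ−1}*‖ ≤ ( min over selections p_τ ∈ K_τ, τ = 1,…,s, of Σ_{τ=1}^{s} ‖p_τ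 − p_{τ−1}‖ with p₀ := q₀ ) + D. -/
open Finset

/-- Euclidean space ℝⁿ. -/
abbrev V (n : ℕ) := EuclideanSpace ℝ (Fin n)

/-- Replacing the first `s` points of a path `q` by those of `p` changes the total length by the
change in the prefix length, up to the length of the connecting segment. -/
theorem sum_norm_sub_splice_le {E : Type*} [SeminormedAddCommGroup E] (p q : ℕ → E) (s : ℕ)
    {m : ℕ} (hm : s + 1 ≤ m) :
    (∑ τ ∈ Icc 1 m, ‖(if τ ≤ s then p τ else q τ) - (if τ - 1 ≤ s then p (τ - 1) else q (τ - 1))‖)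
        + ∑ τ ∈ Icc 1 s, ‖q τ - q (τ - 1)‖ ≤
      (∑ τ ∈ Icc 1 m, ‖q τ - q (τ - 1)‖) + ∑ τ ∈ Icc 1 s, ‖p τ - p (τ - 1)‖
        + ‖q (s + 1) - p s‖ := by
  induction m, hm using Nat.le_induction with
  | base =>
    have h : ∑ τ ∈ Icc 1 s,
        ‖(if τ ≤ s then p τ else q τ) - (if τ - 1 ≤ s then p (τ - 1) else q (τ - 1))‖ =
        ∑ τ ∈ Icc 1 s, ‖p τ - p (τ - 1)‖ := by
      refine Finset.sum_congr rfl fun τ hτ => ?_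
      have hτs := (Finset.mem_Icc.mp hτ).2
      rw [if_pos hτs, if_pos (by omega)]
    rw [Finset.sum_Icc_succ_top (by omega), Finset.sum_Icc_succ_top (by omega), h,
      if_neg (by omega), if_pos (by omega), Nat.add_sub_cancel]
    linarith [norm_nonneg (q (s + 1) - q s)]
  | succ m hm ih =>
    rw [Finset.sum_Icc_succ_top (by omega), Finset.sum_Icc_succ_top (by omega),
      if_neg (by omega), if_neg (by omega)]
    linarith

/-- The prefix of an optimal path is within `diam Θ` of the optimal prefix cost. -/
theorem opt_prefix_near_optimal
    (n e : ℕ) (hn : 1 ≤ n) (he : 1 ≤ e)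
    (Θ : Set (V n)) (hΘconv : Convex ℝ Θ) (hΘcomp : IsCompact Θ) (hΘne : Θ.Nonempty)
    (q₀ : V n) (hq₀ : q₀ ∈ Θ)
    (K : ℕ → Set (V n))
    (hK : ∀ τ ∈ Icc 1 e, (K τ).Nonempty ∧ IsCompact (K τ) ∧ Convex ℝ (K τ) ∧ K τ ⊆ Θ)
    (qopt : ℕ → V n) (hq0 : qopt 0 = q₀) (hqmem : ∀ τ ∈ Icc 1 e, qopt τ ∈ K τ)
    (hqopt : ∀ p : ℕ → V n, p 0 = q₀ → (∀ τ ∈ Icc 1 e, p τ ∈ K τ) →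
      ∑ τ ∈ Icc 1 e, ‖qopt τ - qopt (τ - 1)‖ ≤ ∑ τ ∈ Icc 1 e, ‖p τ - p (τ - 1)‖) :
    ∀ s : ℕ, 1 ≤ s → s < e →
      ∑ τ ∈ Icc 1 s, ‖qopt τ - qopt (τ - 1)‖ ≤
        sInf { c | ∃ p : ℕ → V n, p 0 = q₀ ∧ (∀ τ ∈ Icc 1 s, p τ ∈ K τ) ∧
            c = ∑ τ ∈ Icc 1 s, ‖p τ - p (τ - 1)‖ } + Metric.diam Θ := by
  intro s hs hse
  rw [← sub_le_iff_le_add]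
  apply le_csInf
  · exact ⟨_, qopt, hq0, fun τ hτ => hqmem τ (Finset.Icc_subset_Icc_right hse.le hτ), rfl⟩
  rintro c ⟨p, hp0, hp, rfl⟩
  have hopt := hqopt (fun τ => if τ ≤ s then p τ else qopt τ) (by simp [hp0]) (by
    intro τ hτ
    have hτ' := Finset.mem_Icc.mp hτ
    split_ifs with h
    · exact hp τ (Finset.mem_Icc.mpr ⟨hτ'.1, h⟩)
    · exact hqmem τ hτ)
  have hsplice := sum_norm_sub_splice_le p qopt s (m := e) hse
  have hs_mem : s ∈ Icc 1 e := Finset.mem_Icc.mpr ⟨hs, hse.le⟩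
  have hs_succ : s + 1 ∈ Icc 1 e := Finset.mem_Icc.mpr ⟨by omega, hse⟩
  have hdist : ‖qopt (s + 1) - p s‖ ≤ Metric.diam Θ := by
    rw [← dist_eq_norm]
    exact Metric.dist_le_diam_of_mem hΘcomp.isBounded
      ((hK _ hs_succ).2.2.2 (hqmem _ hs_succ))
      ((hK s hs_mem).2.2.2 (hp s (Finset.mem_Icc.mpr ⟨hs, le_rfl⟩)))
  linarith
end

section
/- Let F, ΔF, M be real n×n matrices with M symmetric, and suppose Σ_{k=0}^{∞} ‖F^k‖² < ∞ and Σ_{k=0}^{∞} ‖(F + ΔF)^k‖² < ∞. Let X and X' be symmetric matrices satisfying the discrete Lyapunov equations X − Fᵀ X F = M and X' − (F + ΔF)ᵀ X' (F + ΔF) = M. Then, writing ΔX := X' − X, the spectral norm satisfies ‖ΔX‖ ≤ 2 · ‖ Σ_{k=0}^{∞} (Fᵀ)^k F^k ‖ · ( 2‖F‖ + ‖ΔF‖ ) · ‖ΔF‖ · ‖X'‖. -/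
open Matrix

open scoped Matrix.Norms.L2Operator InnerProductSpace

section InnerProduct

variable {E : Type*} [NormedAddCommGroup E] [InnerProductSpace ℝ E]

/-- A bounded bilinear form dominated by `C * (‖x‖ ^ 2 + ‖y‖ ^ 2) / 2` comes from an operator of
norm at most `C`. -/
lemma ContinuousLinearMap.opNorm_le_of_inner_le {D : E →L[ℝ] E} {C : ℝ} (hC : 0 ≤ C)
    (h : ∀ x y, ⟪D x, y⟫_ℝ ≤ C * ((‖x‖ ^ 2 + ‖y‖ ^ 2) / 2)) : ‖D‖ ≤ C := by
  refine ContinuousLinearMap.opNorm_le_of_unit_norm hC fun x hx => ?_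
  rcases eq_or_ne (D x) 0 with h0 | h0
  · simpa [h0] using hC
  · have h1 : ‖D x‖ ≠ 0 := norm_ne_zero_iff.mpr h0
    have h2 := h x (‖D x‖⁻¹ • D x)
    rw [real_inner_smul_right, real_inner_self_eq_norm_sq, norm_smul, norm_inv, norm_norm,
      inv_mul_cancel₀ h1, hx] at h2
    have h3 : ‖D x‖⁻¹ * ‖D x‖ ^ 2 = ‖D x‖ := by field_simp
    linarith

/-- If `D - F* D F = R`, `F ^ k → 0` and `K = ∑ (F ^ k)* F ^ k` weakly, then `‖D‖ ≤ ‖R‖ ‖K‖`. -/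
lemma ContinuousLinearMap.opNorm_le_of_stein {D F R K : E →L[ℝ] E}
    (hD : ∀ x y, ⟪D x, y⟫_ℝ = ⟪R x, y⟫_ℝ + ⟪D (F x), F y⟫_ℝ)
    (hK : ∀ x, HasSum (fun k : ℕ => ‖(F ^ k) x‖ ^ 2) ⟪K x, x⟫_ℝ) :
    ‖D‖ ≤ ‖R‖ * ‖K‖ := by
  refine opNorm_le_of_inner_le (by positivity) fun x y => ?_
  have hlim : ∀ z, Filter.Tendsto (fun k => ‖(F ^ k) z‖ ^ 2) Filter.atTop (nhds 0) :=
    fun z => (hK z).summable.tendsto_atTop_zero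
  have hAB : ∀ (A : E →L[ℝ] E) (u v : E), ⟪A u, v⟫_ℝ ≤ ‖A‖ * ((‖u‖ ^ 2 + ‖v‖ ^ 2) / 2) := by
    intro A u v
    calc ⟪A u, v⟫_ℝ ≤ ‖A u‖ * ‖v‖ := real_inner_le_norm _ _
      _ ≤ ‖A‖ * ‖u‖ * ‖v‖ := by gcongr; exact A.le_opNorm u
      _ = ‖A‖ * (‖u‖ * ‖v‖) := by ring
      _ ≤ ‖A‖ * ((‖u‖ ^ 2 + ‖v‖ ^ 2) / 2) := by
        gcongr
        linarith [two_mul_le_add_sq ‖u‖ ‖v‖]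
  have hKle : ∀ z, ⟪K z, z⟫_ℝ ≤ ‖K‖ * ‖z‖ ^ 2 := fun z => by
    have := hAB K z z
    linarith
  have hstep : ∀ N : ℕ, ⟪D x, y⟫_ℝ ≤
      ‖R‖ * ((∑ k ∈ Finset.range N, ‖(F ^ k) x‖ ^ 2 +
        ∑ k ∈ Finset.range N, ‖(F ^ k) y‖ ^ 2) / 2) + ⟪D ((F ^ N) x), (F ^ N) y⟫_ℝ := by
    intro N
    induction N with
    | zero => simp
    | succ N ih =>
      have h1 := hAB R ((F ^ N) x) ((F ^ N) y)
      have h2 := hD ((F ^ N) x) ((F ^ N) y)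
      rw [Finset.sum_range_succ, Finset.sum_range_succ, pow_succ' F,
        mul_apply_eq_comp, mul_apply_eq_comp]
      linarith
  have hbound : ∀ N : ℕ, ⟪D x, y⟫_ℝ ≤ ‖R‖ * ((‖K‖ * ‖x‖ ^ 2 + ‖K‖ * ‖y‖ ^ 2) / 2) +
      ‖D‖ * ((‖(F ^ N) x‖ ^ 2 + ‖(F ^ N) y‖ ^ 2) / 2) := by
    intro N
    refine (hstep N).trans (add_le_add ?_ (hAB D _ _))
    gcongr
    · exact (sum_le_hasSum _ (fun _ _ => by positivity) (hK x)).trans (hKle x)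
    · exact (sum_le_hasSum _ (fun _ _ => by positivity) (hK y)).trans (hKle y)
  have hrem := ((((hlim x).add (hlim y)).div_const 2).const_mul ‖D‖).const_add
    (‖R‖ * ((‖K‖ * ‖x‖ ^ 2 + ‖K‖ * ‖y‖ ^ 2) / 2))
  have := ge_of_tendsto' hrem hbound
  linarith

end InnerProduct

namespace Matrix

variable {n : ℕ}

lemma l2_opNorm_transpose (A : Matrix (Fin n) (Fin n) ℝ) : ‖Aᵀ‖ = ‖A‖ := by
  rw [← conjTranspose_eq_transpose_of_trivial, l2_opNorm_conjTranspose]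

lemma inner_toEuclideanCLM_transpose_mul (A B : Matrix (Fin n) (Fin n) ℝ)
    (x y : EuclideanSpace ℝ (Fin n)) :
    ⟪toEuclideanCLM (𝕜 := ℝ) (Aᵀ * B) x, y⟫_ℝ =
      ⟪toEuclideanCLM (𝕜 := ℝ) B x, toEuclideanCLM (𝕜 := ℝ) A y⟫_ℝ := by
  rw [map_mul, ← conjTranspose_eq_transpose_of_trivial, ← star_eq_conjTranspose, map_star,
    ContinuousLinearMap.star_eq_adjoint, mul_apply_eq_comp,
    ContinuousLinearMap.adjoint_inner_left]

lemma hasSum_norm_sq_toEuclideanCLM_pow {F : Matrix (Fin n) (Fin n) ℝ}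
    (hF : Summable fun k : ℕ => ‖F ^ k‖ ^ 2) (x : EuclideanSpace ℝ (Fin n)) :
    HasSum (fun k : ℕ => ‖(toEuclideanCLM (𝕜 := ℝ) F ^ k) x‖ ^ 2)
      ⟪toEuclideanCLM (𝕜 := ℝ) (∑' k : ℕ, Fᵀ ^ k * F ^ k) x, x⟫_ℝ := by
  have hsum : Summable fun k : ℕ => Fᵀ ^ k * F ^ k := by
    refine Summable.of_norm_bounded hF fun k => ?_
    rw [← transpose_pow, sq]
    exact (norm_mul_le _ _).trans_eq (by rw [l2_opNorm_transpose])
  let φ : Matrix (Fin n) (Fin n) ℝ →ₗ[ℝ] ℝ :=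
    { toFun := fun A => ⟪toEuclideanCLM (𝕜 := ℝ) A x, x⟫_ℝ
      map_add' := fun A B => by simp [inner_add_left]
      map_smul' := fun c A => by simp [real_inner_smul_left] }
  have hφ := hsum.hasSum.map φ φ.continuous_of_finiteDimensional
  refine hφ.congr_fun fun k => ?_
  change _ = ⟪toEuclideanCLM (𝕜 := ℝ) (Fᵀ ^ k * F ^ k) x, x⟫_ℝ
  rw [← transpose_pow, inner_toEuclideanCLM_transpose_mul, real_inner_self_eq_norm_sq, map_pow]

end Matrix

/-- Perturbation bound for the discrete Lyapunov equation:
if `X - Fᵀ X F = M` and `X' - (F + ΔF)ᵀ X' (F + ΔF) = M`, then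
`‖X' - X‖ ≤ 2 ‖∑ (Fᵀ)^k F^k‖ (2‖F‖ + ‖ΔF‖) ‖ΔF‖ ‖X'‖`. -/
theorem lyapunov_perturbation_bound
    (n : ℕ) (F ΔF M X X' : Matrix (Fin n) (Fin n) ℝ)
    (hM : M.IsSymm) (hX : X.IsSymm) (hX' : X'.IsSymm)
    (hFsum : Summable fun k : ℕ => opNorm (F ^ k) ^ 2)
    (hFsum' : Summable fun k : ℕ => opNorm ((F + ΔF) ^ k) ^ 2)
    (hlyap : X - Fᵀ * X * F = M)
    (hlyap' : X' - (F + ΔF)ᵀ * X' * (F + ΔF) = M) :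
    opNorm (X' - X) ≤
      2 * opNorm (∑' k : ℕ, (Fᵀ) ^ k * F ^ k) * (2 * opNorm F + opNorm ΔF) * opNorm ΔF *
        opNorm X' := by
  have hop : ∀ A : Matrix (Fin n) (Fin n) ℝ, opNorm A = ‖A‖ := fun _ => rfl
  simp only [hop] at hFsum ⊢
  set K := ∑' k : ℕ, Fᵀ ^ k * F ^ k
  let R := ΔFᵀ * X' * F + Fᵀ * X' * ΔF + ΔFᵀ * X' * ΔF
  have hR : ‖R‖ ≤ (2 * ‖F‖ + ‖ΔF‖) * ‖ΔF‖ * ‖X'‖ := by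
    have hmul : ∀ A B : Matrix (Fin n) (Fin n) ℝ, ‖Aᵀ * X' * B‖ ≤ ‖A‖ * ‖X'‖ * ‖B‖ := fun A B =>
      (norm_mul₃_le).trans_eq (by rw [l2_opNorm_transpose])
    refine (norm_add₃_le).trans ?_
    linarith [hmul ΔF F, hmul F ΔF, hmul ΔF ΔF]
  have hD : X' - X = R + Fᵀ * ((X' - X) * F) := by
    have h : X' - X = (F + ΔF)ᵀ * X' * (F + ΔF) - Fᵀ * X * F :=
      sub_eq_sub_iff_sub_eq_sub.mp (hlyap'.trans hlyap.symm)
    refine h.trans (sub_eq_zero.mp ?_)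
    simp only [R, transpose_add]
    noncomm_ring
  have hmain : ‖X' - X‖ ≤ ‖R‖ * ‖K‖ := by
    refine ContinuousLinearMap.opNorm_le_of_stein (D := toEuclideanCLM (𝕜 := ℝ) (X' - X))
      (F := toEuclideanCLM (𝕜 := ℝ) F) (R := toEuclideanCLM (𝕜 := ℝ) R)
      (fun x y => ?_) (hasSum_norm_sq_toEuclideanCLM_pow hFsum)
    conv_lhs => rw [hD]
    rw [map_add, _root_.add_apply, inner_add_left,
      inner_toEuclideanCLM_transpose_mul, map_mul, mul_apply_eq_comp]
  calc ‖X' - X‖ ≤ ‖R‖ * ‖K‖ := hmain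
    _ ≤ (2 * ‖F‖ + ‖ΔF‖) * ‖ΔF‖ * ‖X'‖ * ‖K‖ := by gcongr
    _ ≤ 2 * ((2 * ‖F‖ + ‖ΔF‖) * ‖ΔF‖ * ‖X'‖ * ‖K‖) :=
      le_mul_of_one_le_left (by positivity) one_le_two
    _ = 2 * ‖K‖ * (2 * ‖F‖ + ‖ΔF‖) * ‖ΔF‖ * ‖X'‖ := by ring
end
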